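/- Assume F(∞) := lim_{r→∞} F(r) < ∞, P₁(∞) + P₂(∞) < ∞, and P₁(∞) + P₂(∞) < F(∞), where P_i(∞) = lim_{r→∞} P_i(r). Define the successive approximations u₁⁰(r) = a₁, u₂⁰(r) = a₂ for all r ≥ 0, and for m ≥ 1: u₁^m(r) = a₁ + ∫₀^r (B₁⁻(t)·∫₀^t B₁⁺(s) f₁(u₁^{m−1}(s),u₂^{m−1}(s)) ds)^{1/k₁} dt and u₂^m(r) = a₂ + ∫₀^r (B₂⁻(t)·∫₀^t B₂⁺(s) f₂(u₁^{m−1}(s),u₂^{m−1}(s)) ds)^{1/k₂} dt. Then for every m ≥ 1 and every r ≥ 0 one has u₁^m(r) + u₂^m(r) ≤ F⁻¹(P₁(∞) + P₂(∞)) < ∞; in particular the nondecreasing sequences {u₁^m(r)} and {u₂^m(r)} are uniformly bounded in m and r. -/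

import Mathlib

open Real Filter MeasureTheory Set

noncomputable section

/-- A pair `(u₁, u₂)` of continuous functions on `[0, ∞)` is a radial solution of the
`(k₁,k₂)`-Hessian system with convection term, with central value `(a₁, a₂)`, in the
radial integral formulation. -/
def IsRadialSolution (k₁ k₂ : ℕ) (a₁ a₂ : ℝ)
    (B₁m B₁p B₂m B₂p : ℝ → ℝ) (f₁ f₂ : ℝ → ℝ → ℝ) (u₁ u₂ : ℝ → ℝ) : Prop :=
  ContinuousOn u₁ (Set.Ici 0) ∧ ContinuousOn u₂ (Set.Ici 0) ∧
  (∀ r ∈ Set.Ici (0:ℝ),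
    u₁ r = a₁ + ∫ y in (0:ℝ)..r,
      (B₁m y * ∫ t in (0:ℝ)..y, B₁p t * f₁ (u₁ t) (u₂ t)) ^ (1/(k₁:ℝ))) ∧
  (∀ r ∈ Set.Ici (0:ℝ),
    u₂ r = a₂ + ∫ y in (0:ℝ)..r,
      (B₂m y * ∫ t in (0:ℝ)..y, B₂p t * f₂ (u₁ t) (u₂ t)) ^ (1/(k₂:ℝ)))

/-- The primitive of a function continuous on `[0, ∞)` is continuous on `[0, ∞)`. -/
lemma continuousOn_primitive_Ici {h : ℝ → ℝ} (hh : ContinuousOn h (Ici 0)) :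
    ContinuousOn (fun x => ∫ t in (0:ℝ)..x, h t) (Ici 0) := by
  have hc : Continuous fun t => h (max t 0) :=
    hh.comp_continuous (by fun_prop) fun t => le_max_right t 0
  have h1 : Continuous fun x => ∫ t in (0:ℝ)..x, h (max t 0) :=
    intervalIntegral.continuous_primitive (fun a b => hc.intervalIntegrable a b) 0
  refine h1.continuousOn.congr fun x hx => ?_
  refine intervalIntegral.integral_congr fun t ht => ?_
  rw [uIcc_of_le (mem_Ici.1 hx)] at ht
  simp only [max_eq_left ht.1]

lemma intervalIntegrable_of_continuousOn_Ici {h : ℝ → ℝ} (hh : ContinuousOn h (Ici 0))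
    {r : ℝ} (hr : 0 ≤ r) : IntervalIntegrable h volume 0 r := by
  apply ContinuousOn.intervalIntegrable
  rw [uIcc_of_le hr]
  exact hh.mono fun t ht => ht.1

/-- An upper bound for an interval integral of a nonnegative function which needs no
integrability of that function. -/
lemma intervalIntegral_le_of_nonneg {g h : ℝ → ℝ} {r : ℝ} (hr : 0 ≤ r)
    (hh : ContinuousOn h (Ici 0)) (h0 : ∀ t, 0 ≤ t → t ≤ r → 0 ≤ g t)
    (hle : ∀ t, 0 ≤ t → t ≤ r → g t ≤ h t) :
    ∫ t in (0:ℝ)..r, g t ≤ ∫ t in (0:ℝ)..r, h t := by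
  rw [intervalIntegral.integral_of_le hr, intervalIntegral.integral_of_le hr]
  refine integral_mono_of_nonneg ?_
    ((intervalIntegrable_iff_integrableOn_Ioc_of_le hr).1
      (intervalIntegrable_of_continuousOn_Ici hh hr)) ?_
  · filter_upwards [ae_restrict_mem measurableSet_Ioc] with t ht
    exact h0 t ht.1.le ht.2
  · filter_upwards [ae_restrict_mem measurableSet_Ioc] with t ht
    exact hle t ht.1.le ht.2

/-- Regularity and sign of the radial weights. -/
lemma radial_weight_properties {N k : ℕ} (hN : 1 ≤ N) (hk : 1 ≤ k) {b p : ℝ → ℝ}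
    (hbc : ContinuousOn b (Ici 0)) (hpc : ContinuousOn p (Ici 0))
    (hb0 : ∀ t ∈ Ici (0:ℝ), 0 ≤ b t) (hp0 : ∀ t ∈ Ici (0:ℝ), 0 ≤ p t)
    {C : ℝ} (hC : 0 < C) {Bm Bp : ℝ → ℝ}
    (hBm : ∀ ξ : ℝ, Bm ξ = ξ ^ ((k : ℤ) - (N : ℤ)) / C *
      Real.exp (-(∫ t in (0:ℝ)..ξ, (1 / C) * t ^ (k - 1) * b t)))
    (hBp : ∀ ξ : ℝ, Bp ξ = ξ ^ (N - 1) *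
      Real.exp (∫ t in (0:ℝ)..ξ, (1 / C) * t ^ (k - 1) * b t) * p ξ) :
    (∀ t, 0 ≤ t → 0 ≤ Bm t) ∧ (∀ t, 0 ≤ t → 0 ≤ Bp t) ∧ ContinuousOn Bp (Ici 0) ∧
      ContinuousOn (fun t => (Bm t * ∫ s in (0:ℝ)..t, Bp s) ^ (1 / (k:ℝ))) (Ici 0) := by
  set E : ℝ → ℝ := fun ξ => ∫ t in (0:ℝ)..ξ, (1 / C) * t ^ (k - 1) * b t with hE
  have hEint : ContinuousOn (fun t => (1 / C) * t ^ (k - 1) * b t) (Ici 0) := by fun_prop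
  have hEc : ContinuousOn E (Ici 0) := continuousOn_primitive_Ici hEint
  have hEmono : ∀ s t, 0 ≤ s → s ≤ t → E s ≤ E t := by
    intro s t hs hst
    have hi := intervalIntegral.integral_add_adjacent_intervals
      (intervalIntegrable_of_continuousOn_Ici hEint hs)
      ((intervalIntegrable_of_continuousOn_Ici hEint hs).symm.trans
        (intervalIntegrable_of_continuousOn_Ici hEint (hs.trans hst)))
    have h0 : 0 ≤ ∫ x in s..t, (1 / C) * x ^ (k - 1) * b x := by
      refine intervalIntegral.integral_nonneg hst fun x hx => ?_
      have hx0 : 0 ≤ x := hs.trans hx.1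
      have := hb0 x hx0
      positivity
    simp only [hE]
    linarith
  have hBm' : ∀ ξ, Bm ξ = ξ ^ ((k : ℤ) - (N : ℤ)) / C * Real.exp (-E ξ) := hBm
  have hBp' : ∀ ξ, Bp ξ = ξ ^ (N - 1) * Real.exp (E ξ) * p ξ := hBp
  clear_value E
  have hm0 : ∀ t, 0 ≤ t → 0 ≤ Bm t := by
    intro t ht
    rw [hBm']
    positivity
  have hq0 : ∀ t, 0 ≤ t → 0 ≤ Bp t := by
    intro t ht
    rw [hBp']
    have := hp0 t ht
    positivity
  have hBpc : ContinuousOn Bp (Ici 0) := by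
    rw [funext hBp']
    fun_prop
  have hIc := continuousOn_primitive_Ici hBpc
  refine ⟨hm0, hq0, hBpc, ContinuousOn.rpow_const ?_ fun t _ => Or.inr (by positivity)⟩
  intro t ht
  rcases eq_or_lt_of_le (mem_Ici.1 ht) with rfl | ht0
  · obtain ⟨M, hM⟩ := (isCompact_Icc (a := (0:ℝ)) (b := 1)).bddAbove_image
      (hpc.mono fun t ht => ht.1)
    have hM' : ∀ s, 0 ≤ s → s ≤ 1 → p s ≤ M := fun s h1 h2 => hM ⟨s, ⟨h1, h2⟩, rfl⟩
    have hbound : ∀ t, 0 ≤ t → t ≤ 1 → Bm t * ∫ s in (0:ℝ)..t, Bp s ≤ t ^ k * (M / C) := by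
      intro t ht ht1
      have hM0 : 0 ≤ M := (hp0 0 self_mem_Ici).trans (hM' 0 le_rfl zero_le_one)
      rcases eq_or_lt_of_le ht with rfl | ht0
      · simp only [intervalIntegral.integral_same, mul_zero]
        positivity
      have h1 : ∫ s in (0:ℝ)..t, Bp s ≤ ∫ s in (0:ℝ)..t, t ^ (N - 1) * Real.exp (E t) * M := by
        refine intervalIntegral_le_of_nonneg ht continuousOn_const (fun s h _ => hq0 s h) ?_
        intro s hs hst
        rw [hBp']
        have := hp0 s hs
        have := hM' s hs (hst.trans ht1)
        have := hEmono s t hs hst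
        gcongr
      rw [intervalIntegral.integral_const, smul_eq_mul, sub_zero] at h1
      refine (mul_le_mul_of_nonneg_left h1 (hm0 t ht)).trans_eq ?_
      have h2 : t * t ^ (N - 1) = t ^ N := by rw [← pow_succ', Nat.sub_add_cancel hN]
      have h3 : Real.exp (-E t) * Real.exp (E t) = 1 := by rw [← Real.exp_add]; simp
      have h4 : t ^ ((k : ℤ) - (N : ℤ)) * t ^ N = t ^ k := by
        rw [← zpow_natCast t N, ← zpow_add₀ ht0.ne', sub_add_cancel, zpow_natCast]
      rw [hBm']
      calc _ = (t ^ ((k : ℤ) - (N : ℤ)) * (t * t ^ (N - 1))) *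
            (Real.exp (-E t) * Real.exp (E t)) * (M / C) := by ring
        _ = _ := by rw [h2, h3, h4, mul_one]
    have hlim : Tendsto (fun t : ℝ => t ^ k * (M / C)) (nhdsWithin 0 (Ici 0)) (nhds 0) := by
      have : Continuous fun t : ℝ => t ^ k * (M / C) := by fun_prop
      have h := this.continuousWithinAt (s := Ici 0) (x := 0)
      simpa [ContinuousWithinAt, Nat.ne_of_gt hk] using h
    have hnhds : ∀ᶠ t in nhdsWithin (0:ℝ) (Ici 0), t ∈ Icc (0:ℝ) 1 :=
      Icc_mem_nhdsGE zero_lt_one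
    simp only [ContinuousWithinAt, intervalIntegral.integral_same, mul_zero]
    refine squeeze_zero' ?_ ?_ hlim
    · filter_upwards [hnhds] with t ht
      exact mul_nonneg (hm0 t ht.1) (intervalIntegral.integral_nonneg ht.1 fun s hs => hq0 s hs.1)
    · filter_upwards [hnhds] with t ht
      exact hbound t ht.1 ht.2
  · refine ContinuousWithinAt.mul ?_ (hIc t ht)
    rw [funext hBm']
    have h1 : ContinuousWithinAt (fun ξ : ℝ => ξ ^ ((k : ℤ) - (N : ℤ))) (Ici 0) t :=
      (continuousAt_zpow₀ t _ (Or.inl ht0.ne')).continuousWithinAt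
    exact (h1.div_const C).mul ((hEc t ht).neg.rexp)

/-- Solution of the separable problem `H' = g(H) φ`, `H(0) = a`, obtained by inverting
`r ↦ ∫ₐ^r 1/g`, in integrated form. -/
lemma exists_separable_solution {g φ : ℝ → ℝ} (hg : Continuous g) (hgpos : ∀ t, 0 < g t)
    (hφ : Continuous φ) (hφ0 : ∀ t, 0 ≤ φ t) {a L : ℝ}
    (hL : Tendsto (fun r => ∫ t in a..r, 1 / g t) atTop (nhds L))
    (hlt : ∀ r, 0 ≤ r → ∫ t in (0:ℝ)..r, φ t < L) :
    ∃ H : ℝ → ℝ, ContinuousOn H (Ici 0) ∧ MonotoneOn H (Ici 0) ∧ (∀ r, 0 ≤ r → a ≤ H r) ∧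
      (∀ r, 0 ≤ r → ∫ t in a..H r, 1 / g t = ∫ t in (0:ℝ)..r, φ t) ∧
      ∀ r, 0 ≤ r → ∫ t in (0:ℝ)..r, g (H t) * φ t = H r - a := by
  set F : ℝ → ℝ := fun r => ∫ t in a..r, 1 / g t with hF
  have hgi : Continuous fun t => 1 / g t := continuous_const.div hg fun t => (hgpos t).ne'
  have hFd : ∀ r, HasDerivAt F (1 / g r) r := fun r => hgi.integral_hasStrictDerivAt a r |>.hasDerivAt
  have hFa : F a = 0 := intervalIntegral.integral_same
  have hFmono : StrictMono F := strictMono_of_hasDerivAt_pos hFd fun r => by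
    have := hgpos r
    positivity
  have hFc : Continuous F := continuous_iff_continuousAt.2 fun r => (hFd r).continuousAt
  have hemb : Topology.IsEmbedding F := hFmono.isEmbedding_of_ordConnected
    (isPreconnected_range hFc).ordConnected
  set P : ℝ → ℝ := fun r => ∫ t in (0:ℝ)..r, φ t with hP
  have hPd : ∀ r, HasDerivAt P (φ r) r := fun r => hφ.integral_hasStrictDerivAt 0 r |>.hasDerivAt
  have hP0 : P 0 = 0 := intervalIntegral.integral_same
  have hPmono : Monotone P := monotone_of_hasDerivAt_nonneg hPd hφ0
  have hneg : F (a - 1) < 0 := hFa ▸ hFmono (by linarith)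
  have hinv : ∀ y ∈ Ioo (F (a - 1)) L, F (Function.invFun F y) = y := by
    intro y hy
    obtain ⟨x, hx1, hx2⟩ := ((hL.eventually (lt_mem_nhds hy.2)).and
      (eventually_ge_atTop (a - 1))).exists
    obtain ⟨z, -, hz⟩ := intermediate_value_Icc hx2 hFc.continuousOn ⟨hy.1.le, hx1.le⟩
    exact Function.invFun_eq ⟨z, hz⟩
  have hPmem : ∀ r, 0 ≤ r → P r ∈ Ioo (F (a - 1)) L := fun r hr =>
    ⟨hneg.trans_le (hP0 ▸ hPmono hr), hlt r hr⟩
  have hinvd : ∀ y ∈ Ioo (F (a - 1)) L,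
      HasDerivAt (Function.invFun F) (g (Function.invFun F y)) y := by
    intro y hy
    have hev : ∀ᶠ z in nhds y, F (Function.invFun F z) = z := by
      filter_upwards [Ioo_mem_nhds hy.1 hy.2] with z hz using hinv z hz
    have hcont : ContinuousAt (Function.invFun F) y := by
      rw [hemb.isInducing.continuousAt_iff]
      exact continuousAt_id.congr (hev.mono fun z hz => hz.symm)
    have := HasDerivAt.of_local_left_inverse hcont (hFd _)
      (one_div_pos.2 (hgpos _)).ne' hev
    simpa using this
  have hHd : ∀ r, 0 ≤ r → HasDerivAt (fun r => Function.invFun F (P r))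
      (g (Function.invFun F (P r)) * φ r) r := fun r hr =>
    (hinvd (P r) (hPmem r hr)).comp r (hPd r)
  have hHF : ∀ r, 0 ≤ r → F (Function.invFun F (P r)) = P r := fun r hr => hinv _ (hPmem r hr)
  have hHc : ContinuousOn (fun r => Function.invFun F (P r)) (Ici 0) := fun r hr =>
    (hHd r hr).continuousAt.continuousWithinAt
  refine ⟨fun r => Function.invFun F (P r), hHc, ?_, ?_, hHF, ?_⟩
  · intro r hr s hs hrs
    rw [← hFmono.le_iff_le]
    simp only [hHF r hr, hHF s hs]
    exact hPmono hrs
  · intro r hr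
    rw [← hFmono.le_iff_le, hHF r hr, hFa, ← hP0]
    exact hPmono hr
  · intro r hr
    have hH0 : Function.invFun F (P 0) = a :=
      hFmono.injective (by rw [hHF 0 le_rfl, hP0, hFa])
    rw [intervalIntegral.integral_eq_sub_of_hasDerivAt
      (f := fun r => Function.invFun F (P r)), hH0]
    · intro t ht
      rw [uIcc_of_le hr] at ht
      exact hHd t ht.1
    · exact intervalIntegrable_of_continuousOn_Ici
        ((hg.comp_continuousOn hHc).mul hφ.continuousOn) hr

/-- One step of the iteration preserves nonnegativity, and is dominated by the iterate of an upper
barrier `H`. -/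
lemma iteration_step_bounds {k : ℕ} {Bm Bp H u w : ℝ → ℝ} {f : ℝ → ℝ → ℝ}
    (hm0 : ∀ t, 0 ≤ t → 0 ≤ Bm t) (hq0 : ∀ t, 0 ≤ t → 0 ≤ Bp t) (hBpc : ContinuousOn Bp (Ici 0))
    (hφc : ContinuousOn (fun t => (Bm t * ∫ s in (0:ℝ)..t, Bp s) ^ (1 / (k:ℝ))) (Ici 0))
    (hf0 : ∀ x ∈ Ici (0:ℝ), ∀ y ∈ Ici (0:ℝ), 0 ≤ f x y)
    (hfmono : ∀ x xQ y yQ : ℝ, 0 ≤ x → x ≤ xQ → 0 ≤ y → y ≤ yQ → f x y ≤ f xQ yQ)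
    (hHmono : MonotoneOn H (Ici 0))
    (hfHc : ContinuousOn (fun t => f (H t) (H t) ^ (1 / (k:ℝ))) (Ici 0))
    (hu : ∀ t, 0 ≤ t → 0 ≤ u t) (hw : ∀ t, 0 ≤ t → 0 ≤ w t)
    (huw : ∀ t, 0 ≤ t → u t + w t ≤ H t) {r : ℝ} (hr : 0 ≤ r) :
    0 ≤ ∫ t in (0:ℝ)..r, (Bm t * ∫ s in (0:ℝ)..t, Bp s * f (u s) (w s)) ^ (1 / (k:ℝ)) ∧
    ∫ t in (0:ℝ)..r, (Bm t * ∫ s in (0:ℝ)..t, Bp s * f (u s) (w s)) ^ (1 / (k:ℝ)) ≤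
      ∫ t in (0:ℝ)..r, f (H t) (H t) ^ (1 / (k:ℝ)) *
        (Bm t * ∫ s in (0:ℝ)..t, Bp s) ^ (1 / (k:ℝ)) := by
  have hin : ∀ t, 0 ≤ t → 0 ≤ Bm t * ∫ s in (0:ℝ)..t, Bp s * f (u s) (w s) := fun t ht =>
    mul_nonneg (hm0 t ht) (intervalIntegral.integral_nonneg ht fun s hs =>
      mul_nonneg (hq0 s hs.1) (hf0 _ (hu s hs.1) _ (hw s hs.1)))
  refine ⟨intervalIntegral.integral_nonneg hr fun t ht => Real.rpow_nonneg (hin t ht.1) _,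
    intervalIntegral_le_of_nonneg hr (hfHc.mul hφc)
      (fun t ht _ => Real.rpow_nonneg (hin t ht) _) fun t ht _ => ?_⟩
  have hH0 : 0 ≤ H t := (add_nonneg (hu t ht) (hw t ht)).trans (huw t ht)
  rw [← Real.mul_rpow (hf0 _ hH0 _ hH0)
    (mul_nonneg (hm0 t ht) (intervalIntegral.integral_nonneg ht fun s hs => hq0 s hs.1))]
  refine Real.rpow_le_rpow (hin t ht) ?_ (by positivity)
  rw [mul_left_comm]
  refine mul_le_mul_of_nonneg_left ?_ (hm0 t ht)
  rw [← intervalIntegral.integral_const_mul]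
  refine intervalIntegral_le_of_nonneg ht (continuousOn_const.mul hBpc)
    (fun s hs _ => mul_nonneg (hq0 s hs) (hf0 _ (hu s hs) _ (hw s hs))) fun s hs hst => ?_
  rw [mul_comm]
  refine mul_le_mul_of_nonneg_right ?_ (hq0 s hs)
  have h1 := hu s hs
  have h2 := hw s hs
  have h3 := huw s hs
  have h4 := hHmono hs ht hst
  exact hfmono _ _ _ _ h1 (by linarith) h2 (by linarith)

/-- Uniform bound for the successive approximations in the bounded case: if
`F(∞) < ∞`, `P₁(∞) + P₂(∞) < ∞` and `P₁(∞) + P₂(∞) < F(∞)`, then for every `m ≥ 1`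
and `r ≥ 0`, `u₁^m(r) + u₂^m(r) ≤ F⁻¹(P₁(∞) + P₂(∞))`; in particular the sequences
are uniformly bounded in `m` and `r`. -/
theorem hessian_successive_approximations_uniformly_bounded
    (N k₁ k₂ : ℕ) (hN : 3 ≤ N) (hk₁ : 1 ≤ k₁) (hk₁N : k₁ ≤ N) (hk₂ : 1 ≤ k₂) (hk₂N : k₂ ≤ N)
    (b₁ b₂ p₁ p₂ : ℝ → ℝ)
    (hb₁c : ContinuousOn b₁ (Set.Ici 0)) (hb₂c : ContinuousOn b₂ (Set.Ici 0))
    (hp₁c : ContinuousOn p₁ (Set.Ici 0)) (hp₂c : ContinuousOn p₂ (Set.Ici 0))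
    (hb₁0 : ∀ t ∈ Set.Ici (0:ℝ), 0 ≤ b₁ t) (hb₂0 : ∀ t ∈ Set.Ici (0:ℝ), 0 ≤ b₂ t)
    (hp₁0 : ∀ t ∈ Set.Ici (0:ℝ), 0 ≤ p₁ t) (hp₂0 : ∀ t ∈ Set.Ici (0:ℝ), 0 ≤ p₂ t)
    (C₀ C₀₀ : ℝ)
    (hC₀ : C₀ = (Nat.factorial (N-1) : ℝ) / ((Nat.factorial k₁ : ℝ) * (Nat.factorial (N - k₁) : ℝ)))
    (hC₀₀ : C₀₀ = (Nat.factorial (N-1) : ℝ) / ((Nat.factorial k₂ : ℝ) * (Nat.factorial (N - k₂) : ℝ)))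
    (B₁m B₁p B₂m B₂p : ℝ → ℝ)
    (hB₁m : ∀ ξ : ℝ, B₁m ξ = ξ ^ ((k₁ : ℤ) - (N : ℤ)) / C₀ *
      Real.exp (-(∫ t in (0:ℝ)..ξ, (1 / C₀) * t ^ (k₁ - 1) * b₁ t)))
    (hB₁p : ∀ ξ : ℝ, B₁p ξ = ξ ^ (N - 1) *
      Real.exp (∫ t in (0:ℝ)..ξ, (1 / C₀) * t ^ (k₁ - 1) * b₁ t) * p₁ ξ)
    (hB₂m : ∀ ξ : ℝ, B₂m ξ = ξ ^ ((k₂ : ℤ) - (N : ℤ)) / C₀₀ *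
      Real.exp (-(∫ t in (0:ℝ)..ξ, (1 / C₀₀) * t ^ (k₂ - 1) * b₂ t)))
    (hB₂p : ∀ ξ : ℝ, B₂p ξ = ξ ^ (N - 1) *
      Real.exp (∫ t in (0:ℝ)..ξ, (1 / C₀₀) * t ^ (k₂ - 1) * b₂ t) * p₂ ξ)
    (a₁ a₂ : ℝ) (ha₁ : 0 ≤ a₁) (ha₂ : 0 ≤ a₂) (ha : 0 < a₁ + a₂)
    (f₁ f₂ : ℝ → ℝ → ℝ)
    (hf₁c : ContinuousOn (fun q : ℝ × ℝ => f₁ q.1 q.2) (Set.Ici 0 ×ˢ Set.Ici 0))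
    (hf₂c : ContinuousOn (fun q : ℝ × ℝ => f₂ q.1 q.2) (Set.Ici 0 ×ˢ Set.Ici 0))
    (hf₁0 : ∀ x ∈ Set.Ici (0:ℝ), ∀ y ∈ Set.Ici (0:ℝ), 0 ≤ f₁ x y)
    (hf₂0 : ∀ x ∈ Set.Ici (0:ℝ), ∀ y ∈ Set.Ici (0:ℝ), 0 ≤ f₂ x y)
    (hf₁mono : ∀ x xQ y yQ : ℝ, 0 ≤ x → x ≤ xQ → 0 ≤ y → y ≤ yQ → f₁ x y ≤ f₁ xQ yQ)
    (hf₂mono : ∀ x xQ y yQ : ℝ, 0 ≤ x → x ≤ xQ → 0 ≤ y → y ≤ yQ → f₂ x y ≤ f₂ xQ yQ)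
    (P₁ P₂ : ℝ → ℝ)
    (hP₁ : ∀ r : ℝ, P₁ r = ∫ t in (0:ℝ)..r, (B₁m t * ∫ s in (0:ℝ)..t, B₁p s) ^ (1/(k₁:ℝ)))
    (hP₂ : ∀ r : ℝ, P₂ r = ∫ t in (0:ℝ)..r, (B₂m t * ∫ s in (0:ℝ)..t, B₂p s) ^ (1/(k₂:ℝ)))
    (F : ℝ → ℝ)
    (hF : ∀ r : ℝ, F r = ∫ t in (a₁+a₂)..r, 1 / (f₁ t t ^ (1/(k₁:ℝ)) + f₂ t t ^ (1/(k₂:ℝ))))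
    (hfpos : ∀ t : ℝ, a₁ + a₂ ≤ t → 0 < f₁ t t ^ (1/(k₁:ℝ)) + f₂ t t ^ (1/(k₂:ℝ)))
    (Flim : ℝ) (hFlim : Tendsto F atTop (nhds Flim))
    (P₁lim P₂lim : ℝ)
    (hP₁lim : Tendsto P₁ atTop (nhds P₁lim)) (hP₂lim : Tendsto P₂ atTop (nhds P₂lim))
    (hPltF : P₁lim + P₂lim < Flim)
    (Finv : ℝ → ℝ) (hFinv : ∀ s : ℝ, a₁ + a₂ ≤ s → Finv (F s) = s)
    (v₁ v₂ : ℕ → ℝ → ℝ)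
    (hv₁0 : ∀ r : ℝ, v₁ 0 r = a₁) (hv₂0 : ∀ r : ℝ, v₂ 0 r = a₂)
    (hv₁s : ∀ m : ℕ, ∀ r : ℝ, v₁ (m+1) r = a₁ + ∫ t in (0:ℝ)..r,
      (B₁m t * ∫ s in (0:ℝ)..t, B₁p s * f₁ (v₁ m s) (v₂ m s)) ^ (1/(k₁:ℝ)))
    (hv₂s : ∀ m : ℕ, ∀ r : ℝ, v₂ (m+1) r = a₂ + ∫ t in (0:ℝ)..r,
      (B₂m t * ∫ s in (0:ℝ)..t, B₂p s * f₂ (v₁ m s) (v₂ m s)) ^ (1/(k₂:ℝ))) :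
    (∀ m : ℕ, 1 ≤ m → ∀ r ∈ Set.Ici (0:ℝ), v₁ m r + v₂ m r ≤ Finv (P₁lim + P₂lim)) ∧
    ∃ M : ℝ, ∀ m : ℕ, ∀ r ∈ Set.Ici (0:ℝ), v₁ m r ≤ M ∧ v₂ m r ≤ M := by
  obtain ⟨hm₁, hq₁, hBc₁, hφ₁⟩ := radial_weight_properties (by omega) hk₁ hb₁c hp₁c hb₁0 hp₁0
    (hC₀ ▸ by positivity) hB₁m hB₁p
  obtain ⟨hm₂, hq₂, hBc₂, hφ₂⟩ := radial_weight_properties (by omega) hk₂ hb₂c hp₂c hb₂0 hp₂0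
    (hC₀₀ ▸ by positivity) hB₂m hB₂p
  set φ₁ : ℝ → ℝ := fun t => (B₁m t * ∫ s in (0:ℝ)..t, B₁p s) ^ (1 / (k₁:ℝ)) with hφ₁def
  set φ₂ : ℝ → ℝ := fun t => (B₂m t * ∫ s in (0:ℝ)..t, B₂p s) ^ (1 / (k₂:ℝ)) with hφ₂def
  have hφ₁0 : ∀ t, 0 ≤ t → 0 ≤ φ₁ t := fun t ht => Real.rpow_nonneg
    (mul_nonneg (hm₁ t ht) (intervalIntegral.integral_nonneg ht fun s hs => hq₁ s hs.1)) _
  have hφ₂0 : ∀ t, 0 ≤ t → 0 ≤ φ₂ t := fun t ht => Real.rpow_nonneg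
    (mul_nonneg (hm₂ t ht) (intervalIntegral.integral_nonneg ht fun s hs => hq₂ s hs.1)) _
  have hdiag₁ : ContinuousOn (fun t => f₁ t t ^ (1 / (k₁:ℝ))) (Ici 0) :=
    (hf₁c.comp (f := fun t : ℝ => (t, t)) (by fun_prop) fun t ht => ⟨ht, ht⟩).rpow_const
      fun t _ => Or.inr (by positivity)
  have hdiag₂ : ContinuousOn (fun t => f₂ t t ^ (1 / (k₂:ℝ))) (Ici 0) :=
    (hf₂c.comp (f := fun t : ℝ => (t, t)) (by fun_prop) fun t ht => ⟨ht, ht⟩).rpow_const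
      fun t _ => Or.inr (by positivity)
  set G : ℝ → ℝ := fun t => f₁ t t ^ (1 / (k₁:ℝ)) + f₂ t t ^ (1 / (k₂:ℝ)) with hG
  have hGc : Continuous fun t => G (max t (a₁ + a₂)) :=
    (hdiag₁.add hdiag₂).comp_continuous (by fun_prop) fun t => ha.le.trans (le_max_right _ _)
  have hGpos : ∀ t, 0 < G (max t (a₁ + a₂)) := fun t => hfpos _ (le_max_right _ _)
  have hΦc : Continuous fun t => φ₁ (max t 0) + φ₂ (max t 0) :=
    (hφ₁.add hφ₂).comp_continuous (f := fun t : ℝ => max t 0) (by fun_prop)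
      fun t => le_max_right t 0
  have hΦ0 : ∀ t, 0 ≤ φ₁ (max t 0) + φ₂ (max t 0) := fun t =>
    add_nonneg (hφ₁0 _ (le_max_right _ _)) (hφ₂0 _ (le_max_right _ _))
  have hFeq : ∀ r, a₁ + a₂ ≤ r → F r = ∫ t in (a₁+a₂)..r, 1 / G (max t (a₁ + a₂)) := by
    intro r hr
    rw [hF]
    refine intervalIntegral.integral_congr fun t ht => ?_
    rw [uIcc_of_le hr] at ht
    simp only [max_eq_left ht.1, hG]
  have hPeq : ∀ r, 0 ≤ r → P₁ r + P₂ r = ∫ t in (0:ℝ)..r, (φ₁ (max t 0) + φ₂ (max t 0)) := by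
    intro r hr
    rw [hP₁, hP₂, ← intervalIntegral.integral_add
      (intervalIntegrable_of_continuousOn_Ici hφ₁ hr)
      (intervalIntegrable_of_continuousOn_Ici hφ₂ hr)]
    refine intervalIntegral.integral_congr fun t ht => ?_
    rw [uIcc_of_le hr] at ht
    simp only [max_eq_left ht.1]
  have hPmono : Monotone fun r => ∫ t in (0:ℝ)..r, (φ₁ (max t 0) + φ₂ (max t 0)) :=
    monotone_of_hasDerivAt_nonneg
      (fun r => (hΦc.integral_hasStrictDerivAt 0 r).hasDerivAt) hΦ0
  have hPlim : Tendsto (fun r => ∫ t in (0:ℝ)..r, (φ₁ (max t 0) + φ₂ (max t 0))) atTop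
      (nhds (P₁lim + P₂lim)) :=
    (hP₁lim.add hP₂lim).congr' ((eventually_ge_atTop 0).mono hPeq)
  have hPle : ∀ r, ∫ t in (0:ℝ)..r, (φ₁ (max t 0) + φ₂ (max t 0)) ≤ P₁lim + P₂lim :=
    hPmono.ge_of_tendsto hPlim
  have hFlim' : Tendsto (fun r => ∫ t in (a₁+a₂)..r, 1 / G (max t (a₁ + a₂))) atTop
      (nhds Flim) := hFlim.congr' ((eventually_ge_atTop (a₁ + a₂)).mono hFeq)
  obtain ⟨H, hHc, hHmono, haH, hFH, hHint⟩ := exists_separable_solution hGc hGpos hΦc hΦ0 hFlim'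
    fun r _ => (hPle r).trans_lt hPltF
  have hHmaps : MapsTo H (Ici 0) (Ici 0) := fun t ht => ha.le.trans (haH t ht)
  have hfH₁ : ContinuousOn (fun t => f₁ (H t) (H t) ^ (1 / (k₁:ℝ))) (Ici 0) :=
    hdiag₁.comp hHc hHmaps
  have hfH₂ : ContinuousOn (fun t => f₂ (H t) (H t) ^ (1 / (k₂:ℝ))) (Ici 0) :=
    hdiag₂.comp hHc hHmaps
  have hfφ₁ : ContinuousOn (fun t => f₁ (H t) (H t) ^ (1 / (k₁:ℝ)) * φ₁ t) (Ici 0) := hfH₁.mul hφ₁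
  have hfφ₂ : ContinuousOn (fun t => f₂ (H t) (H t) ^ (1 / (k₂:ℝ)) * φ₂ t) (Ici 0) := hfH₂.mul hφ₂
  have key : ∀ m, (∀ r, 0 ≤ r → 0 ≤ v₁ m r) ∧ (∀ r, 0 ≤ r → 0 ≤ v₂ m r) ∧
      ∀ r, 0 ≤ r → v₁ m r + v₂ m r ≤ H r := by
    intro m
    induction m with
    | zero =>
      refine ⟨fun r _ => ?_, fun r _ => ?_, fun r hr => ?_⟩
      · rwa [hv₁0]
      · rwa [hv₂0]
      · rw [hv₁0, hv₂0]
        exact haH r hr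
    | succ m ih =>
      obtain ⟨ih₁, ih₂, ih₃⟩ := ih
      have s₁ := fun r (hr : 0 ≤ r) => iteration_step_bounds hm₁ hq₁ hBc₁ hφ₁ hf₁0 hf₁mono hHmono
        hfH₁ ih₁ ih₂ ih₃ hr
      have s₂ := fun r (hr : 0 ≤ r) => iteration_step_bounds hm₂ hq₂ hBc₂ hφ₂ hf₂0 hf₂mono hHmono
        hfH₂ ih₁ ih₂ ih₃ hr
      refine ⟨fun r hr => ?_, fun r hr => ?_, fun r hr => ?_⟩
      · rw [hv₁s]
        exact add_nonneg ha₁ (s₁ r hr).1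
      · rw [hv₂s]
        exact add_nonneg ha₂ (s₂ r hr).1
      · have hsum : (∫ t in (0:ℝ)..r, f₁ (H t) (H t) ^ (1 / (k₁:ℝ)) * φ₁ t) +
            (∫ t in (0:ℝ)..r, f₂ (H t) (H t) ^ (1 / (k₂:ℝ)) * φ₂ t) ≤ H r - (a₁ + a₂) := by
          rw [← hHint r hr, ← intervalIntegral.integral_add
            (intervalIntegrable_of_continuousOn_Ici hfφ₁ hr)
            (intervalIntegrable_of_continuousOn_Ici hfφ₂ hr)]
          have hc₁ : ∀ t, 0 ≤ t → 0 ≤ f₁ (H t) (H t) ^ (1 / (k₁:ℝ)) := fun t ht =>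
            Real.rpow_nonneg (hf₁0 _ (hHmaps ht) _ (hHmaps ht)) _
          have hc₂ : ∀ t, 0 ≤ t → 0 ≤ f₂ (H t) (H t) ^ (1 / (k₂:ℝ)) := fun t ht =>
            Real.rpow_nonneg (hf₂0 _ (hHmaps ht) _ (hHmaps ht)) _
          refine intervalIntegral_le_of_nonneg hr
            ((hGc.comp_continuousOn hHc).mul hΦc.continuousOn)
            (fun t ht _ => add_nonneg (mul_nonneg (hc₁ t ht) (hφ₁0 t ht))
              (mul_nonneg (hc₂ t ht) (hφ₂0 t ht))) fun t ht _ => ?_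
          simp only [max_eq_left (haH t ht), max_eq_left ht, hG]
          have := mul_nonneg (hc₁ t ht) (hφ₂0 t ht)
          have := mul_nonneg (hc₂ t ht) (hφ₁0 t ht)
          linarith
        rw [hv₁s, hv₂s]
        have h1 := (s₁ r hr).2
        have h2 := (s₂ r hr).2
        simp only [hφ₁def, hφ₂def] at hsum
        linarith
  obtain ⟨c, hc, hFc⟩ : ∃ c, a₁ + a₂ ≤ c ∧ F c = P₁lim + P₂lim := by
    have hcont : Continuous fun r => ∫ t in (a₁+a₂)..r, 1 / G (max t (a₁ + a₂)) :=
      intervalIntegral.continuous_primitive (fun x y => (continuous_const.div hGc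
        fun t => (hGpos t).ne').intervalIntegrable x y) _
    obtain ⟨x, hx1, hx2⟩ := ((hFlim'.eventually (lt_mem_nhds hPltF)).and
      (eventually_ge_atTop (a₁ + a₂))).exists
    have h0 : 0 ≤ P₁lim + P₂lim := by simpa using hPle 0
    obtain ⟨c, hc, hFc⟩ := intermediate_value_Icc hx2 hcont.continuousOn
      ⟨by simpa using h0, hx1.le⟩
    exact ⟨c, hc.1, (hFeq c hc.1).trans hFc⟩
  have hHle : ∀ r, 0 ≤ r → H r ≤ c := by
    intro r hr
    have hmono : StrictMono fun r => ∫ t in (a₁+a₂)..r, 1 / G (max t (a₁ + a₂)) :=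
      strictMono_of_hasDerivAt_pos (fun r => ((continuous_const.div hGc
        fun t => (hGpos t).ne').integral_hasStrictDerivAt _ r).hasDerivAt)
        fun r => one_div_pos.2 (hGpos r)
    rw [← hmono.le_iff_le]
    rw [hFH r hr, ← hFeq c hc, hFc]
    exact hPle r
  have hbound : ∀ m r, 0 ≤ r → v₁ m r + v₂ m r ≤ c := fun m r hr =>
    ((key m).2.2 r hr).trans (hHle r hr)
  refine ⟨fun m _ r hr => ?_, c, fun m r hr => ?_⟩
  · rw [← hFc, hFinv c hc]
    exact hbound m r hr
  · have h1 := (key m).1 r hr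
    have h2 := (key m).2.1 r hr
    have h3 := hbound m r hr
    exact ⟨by linarith, by linarith⟩
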